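/- arXiv:1808.09854 — 3 statements merged into one kernel-verified Lean document; each statement's English description precedes it below -/
import Mathlib

section
/- Let A be a commutative integral domain that is an algebra over a field of characteristic zero (equivalently, A contains ℚ), equipped with a bracket {·,·} : A × A → A satisfying the Leibniz rule in the first argument: {x·y, z} = x·{y, z} + y·{x, z} for all x, y, z ∈ A. Suppose a ∈ A is a Poisson element, i.e., {a, a'} ∈ a·A for every a' ∈ A, and suppose a = a₁ᵏ·a₂ where k ≥ 1 is an integer, a₁ ∈ A is a prime element, and a₁ does not divide a₂. Then a₁ is a Poisson element, i.e., {a₁, a'} ∈ a₁·A for every a' ∈ A. -/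
/-- The power rule for a map satisfying the Leibniz rule; additivity is not needed. -/
theorem leibniz_pow_succ {A : Type*} [CommRing A] (D : A → A)
    (leibniz : ∀ x y : A, D (x * y) = x * D y + y * D x) (x : A) (n : ℕ) :
    D (x ^ (n + 1)) = ((n + 1 : ℕ) : A) * x ^ n * D x := by
  induction n with
  | zero => simp
  | succ n ih =>
    rw [pow_succ x (n + 1), leibniz, ih]
    push_cast
    ring

/-- Lemma 2.2(2): Let `A` be a commutative integral domain over `ℚ` with a
bracket satisfying the Leibniz rule in the first argument.  If `a = a₁ ^ k * a₂`
is a Poisson element (`{a, A} ⊆ a·A`), where `k ≥ 1`, `a₁` is prime and `a₁`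
does not divide `a₂`, then the prime factor `a₁` is also Poisson. -/
theorem prime_factor_of_poisson_is_poisson
    {A : Type*} [CommRing A] [IsDomain A] [Algebra ℚ A]
    (br : A → A → A)
    (leibniz : ∀ x y z : A, br (x * y) z = x * br y z + y * br x z)
    (a a₁ a₂ : A) (k : ℕ) (hk : 1 ≤ k)
    (ha : a = a₁ ^ k * a₂)
    (hprime : Prime a₁) (hndvd : ¬ a₁ ∣ a₂)
    (hPoisson : ∀ a' : A, a ∣ br a a') :
    ∀ a' : A, a₁ ∣ br a₁ a' := by
  intro a'
  obtain ⟨n, rfl⟩ : ∃ n, k = n + 1 := ⟨k - 1, by omega⟩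
  obtain ⟨c, hc⟩ := hPoisson a'
  have hpow := leibniz_pow_succ (fun x => br x a') (fun x y => leibniz x y a') a₁ n
  rw [ha, leibniz, hpow] at hc
  have hcancel : a₂ * (((n + 1 : ℕ) : A) * br a₁ a') = a₁ * (a₂ * c - br a₂ a') := by
    apply mul_left_cancel₀ (pow_ne_zero n hprime.ne_zero)
    linear_combination hc
  have hunit : IsUnit ((n + 1 : ℕ) : A) := by
    have hq : IsUnit ((n + 1 : ℕ) : ℚ) := (Nat.cast_ne_zero.mpr n.succ_ne_zero).isUnit
    simpa only [map_natCast] using hq.map (algebraMap ℚ A)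
  have hdvd := (hprime.dvd_or_dvd ⟨_, hcancel⟩).resolve_left hndvd
  exact hunit.dvd_mul_left.mp hdvd
end

section
/- Let F be a field and let {·,·} : F × F → F be a bracket that is additive in its first argument and alternating ({x, x} = 0 for all x ∈ F). Let θ : F → F be an additive map, let δ : F → F be any map, and let η ∈ F with η ≠ 0. Suppose d, d' ∈ F satisfy {d, r} = θ(r)·d + δ(r) and {d', r} = θ(r)·d' + δ(r) for all r ∈ F, and that θ(d) = η·d and θ(d') = η·d'. Then d = d'. -/
/-- Uniqueness part of Lemma 2.5: there is at most one distinguished element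
with respect to a Poisson-Cauchon extension. -/
theorem distinguished_element_unique
    {F : Type*} [Field F]
    (br : F → F → F)
    (br_add : ∀ x y z : F, br (x + y) z = br x z + br y z)
    (br_alt : ∀ x : F, br x x = 0)
    (θ : F → F) (θ_add : ∀ x y : F, θ (x + y) = θ x + θ y)
    (δ : F → F) (η : F) (hη : η ≠ 0)
    (d d' : F)
    (hd : ∀ r : F, br d r = θ r * d + δ r)
    (hd' : ∀ r : F, br d' r = θ r * d' + δ r)
    (hθd : θ d = η * d) (hθd' : θ d' = η * d') :
    d = d' := by
  have hθ : θ (d - d') = η * (d - d') := by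
    have h := θ_add (d - d') d'
    rw [sub_add_cancel, hθd, hθd'] at h
    linear_combination -h
  have hbr : br d (d - d') = br d' (d - d') := by
    have h := br_add (d - d') d' (d - d')
    rwa [sub_add_cancel, br_alt, zero_add] at h
  rw [hd, hd', hθ] at hbr
  have hsq : η * (d - d') ^ 2 = 0 := by linear_combination hbr
  have hzero : (d - d') ^ 2 = 0 := (mul_eq_zero.mp hsq).resolve_left hη
  exact sub_eq_zero.mp (pow_eq_zero_iff two_ne_zero |>.mp hzero)
end

section
/- Let F be a division ring, let σ : F → F be an additive map, let Δ : F → F be any map, and let ω ∈ F with ω ≠ 1. Suppose D, D' ∈ F satisfy D·r = σ(r)·D + Δ(r) and D'·r = σ(r)·D' + Δ(r) for all r ∈ F, and that σ(D) = ω·D and σ(D') = ω·D'. Then D = D'. -/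
/-- Uniqueness part of Lemma 3.5: there is at most one distinguished element
with respect to a Cauchon extension. -/
theorem q_distinguished_element_unique
    {F : Type*} [DivisionRing F]
    (σ : F → F) (σ_add : ∀ x y : F, σ (x + y) = σ x + σ y)
    (Δ : F → F) (ω : F) (hω : ω ≠ 1)
    (D D' : F)
    (hD : ∀ r : F, D * r = σ r * D + Δ r)
    (hD' : ∀ r : F, D' * r = σ r * D' + Δ r)
    (hσD : σ D = ω * D) (hσD' : σ D' = ω * D') :
    D = D' := by
  have twist (r : F) : (D - D') * r = σ r * (D - D') := by
    rw [sub_mul, hD, hD', add_sub_add_right_eq_sub, mul_sub]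
  have σ_sub : σ (D - D') = ω * (D - D') := by
    rw [mul_sub, ← hσD, ← hσD', eq_sub_iff_add_eq, ← σ_add, sub_add_cancel]
  by_contra hne
  have hE : D - D' ≠ 0 := sub_ne_zero.mpr hne
  have h := mul_right_cancel₀ hE ((twist (D - D')).trans (by rw [σ_sub]))
  exact hω (mul_right_cancel₀ hE (by rw [one_mul, ← h]))
end
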